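/- Let (δ_n), (h_n) be real sequences and (γ_n) strictly positive, and set ζ_n = h_n/γ_n. If ∑_n ζ_n² < ∞, then the infinite product measures ⊗_{n∈ℕ} μ(δ_n, γ_n) and ⊗_{n∈ℕ} μ(δ_n + h_n, γ_n) on ℝ^ℕ are mutually absolutely continuous. -/

import Mathlib

open MeasureTheory Real

/-- The Cauchy measure on `ℝ` with location parameter `δ` and scale parameter `γ`. -/
noncomputable def cauchyMeasure (δ γ : ℝ) : Measure ℝ :=
  volume.withDensity fun x => ENNReal.ofReal (γ / (π * ((x - δ) ^ 2 + γ ^ 2)))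
open scoped ENNReal symmDiff

section ProductMeasures

open ProbabilityTheory Set

lemma lintegral_pi_prod {ι : Type*} [Fintype ι] {X : ι → Type*} [∀ i, MeasurableSpace (X i)]
    (μ : ∀ i, Measure (X i)) [∀ i, IsProbabilityMeasure (μ i)]
    {f : ∀ i, X i → ℝ≥0∞} (hf : ∀ i, Measurable (f i)) :
    ∫⁻ x, ∏ i, f i (x i) ∂Measure.pi μ = ∏ i, ∫⁻ x, f i x ∂μ i := by
  rw [lintegral_prod_eq_prod_lintegral_of_indepFun Finset.univ
    (fun i (x : ∀ i, X i) => f i (x i))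
    (iIndepFun_pi fun i => (hf i).aemeasurable)
    fun i => (hf i).comp (measurable_pi_apply i)]
  exact Finset.prod_congr rfl fun i _ =>
    (measurePreserving_eval μ i).lintegral_comp (hf i)

lemma pi_withDensity {ι : Type*} [Fintype ι] {X : ι → Type*} [∀ i, MeasurableSpace (X i)]
    (μ : ∀ i, Measure (X i)) [∀ i, IsProbabilityMeasure (μ i)]
    {f : ∀ i, X i → ℝ≥0∞} (hf : ∀ i, Measurable (f i))
    [∀ i, SigmaFinite ((μ i).withDensity (f i))] :
    Measure.pi (fun i => (μ i).withDensity (f i)) =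
      (Measure.pi μ).withDensity fun x => ∏ i, f i (x i) := by
  refine Measure.pi_eq fun s hs => ?_
  rw [withDensity_apply _ (MeasurableSet.univ_pi hs),
    ← lintegral_indicator (MeasurableSet.univ_pi hs)]
  have key : ∀ x : ∀ i, X i, (univ.pi s).indicator (fun x => ∏ i, f i (x i)) x =
      ∏ i, (s i).indicator (f i) (x i) := by
    intro x
    by_cases hx : x ∈ univ.pi s
    · rw [indicator_of_mem hx]
      exact Finset.prod_congr rfl fun i _ => (indicator_of_mem (hx i (mem_univ i)) _).symm
    · rw [indicator_of_notMem hx]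
      simp only [mem_univ_pi, not_forall] at hx
      obtain ⟨i, hi⟩ := hx
      exact (Finset.prod_eq_zero (Finset.mem_univ i) (indicator_of_notMem hi _)).symm
  simp_rw [key]
  rw [lintegral_pi_prod μ fun i => (hf i).indicator (hs i)]
  refine Finset.prod_congr rfl fun i _ => ?_
  rw [withDensity_apply _ (hs i), lintegral_indicator (hs i)]

/-- A quantitative form of absolute continuity for measures with square integrable density. -/
lemma withDensity_le_mul_add_div {α : Type*} [MeasurableSpace α] (μ : Measure α)
    {f : α → ℝ≥0∞} (hf : Measurable f) {t : ℝ≥0∞} (ht : t ≠ 0) (ht' : t ≠ ∞)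
    {s : Set α} (hs : MeasurableSet s) :
    μ.withDensity f s ≤ t * μ s + (∫⁻ x, f x ^ 2 ∂μ) / t := by
  have pointwise : ∀ x, f x ≤ t + f x ^ 2 / t := by
    intro x
    rcases le_total (f x) t with h | h
    · exact h.trans le_self_add
    · refine le_add_left ?_
      rw [ENNReal.le_div_iff_mul_le (Or.inl ht) (Or.inl ht'), sq]
      gcongr
  calc μ.withDensity f s = ∫⁻ x in s, f x ∂μ := withDensity_apply _ hs
    _ ≤ ∫⁻ x in s, (t + f x ^ 2 / t) ∂μ := lintegral_mono fun x => pointwise x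
    _ = t * μ s + ∫⁻ x in s, f x ^ 2 / t ∂μ := by
      rw [lintegral_add_left measurable_const, setLIntegral_const]
    _ ≤ t * μ s + ∫⁻ x, f x ^ 2 / t ∂μ := by gcongr; exact Measure.restrict_le_self
    _ = t * μ s + (∫⁻ x, f x ^ 2 ∂μ) / t := by
      simp_rw [div_eq_mul_inv]
      rw [lintegral_mul_const _ (hf.pow_const 2)]

lemma absolutelyContinuous_of_forall_cylinder_le {ι : Type*} {X : ι → Type*}
    [∀ i, MeasurableSpace (X i)] {P Q : Measure (∀ i, X i)} [IsFiniteMeasure P]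
    [IsFiniteMeasure Q] {C : ℝ≥0∞} (hC : C ≠ ∞)
    (h : ∀ t : ℝ≥0∞, t ≠ 0 → t ≠ ∞ → ∀ s ∈ measurableCylinders X, Q s ≤ t * P s + C / t) :
    Q ≪ P := by
  refine Measure.AbsolutelyContinuous.mk fun A hA hPA => ?_
  have approx : ∀ t : ℝ≥0∞, t ≠ 0 → t ≠ ∞ → ∀ ε : ℝ≥0∞, 0 < ε →
      Q A ≤ ε + t * ε + C / t := by
    intro t ht ht' ε hε
    obtain ⟨s, hs, hsA⟩ := exists_measure_symmDiff_lt_of_generateFrom_isSetRing (μ := P + Q)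
      (isSetRing_measurableCylinders (α := X))
      ⟨{univ}, countable_singleton _,
        singleton_subset_iff.2 isSetAlgebra_measurableCylinders.univ_mem, by simp⟩
      generateFrom_measurableCylinders.symm hA hε
    rw [Measure.add_apply] at hsA
    have hP : P s ≤ ε := calc
      P s ≤ P (s ∆ A ∪ A) := measure_mono fun x hx => by
        by_cases hxA : x ∈ A
        · exact Or.inr hxA
        · exact Or.inl (Or.inl ⟨hx, hxA⟩)
      _ ≤ P (s ∆ A) + P A := measure_union_le _ _
      _ ≤ ε := by rw [hPA, add_zero]; exact le_self_add.trans hsA.le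
    calc Q A ≤ Q (s ∆ A ∪ s) := measure_mono fun x hx => by
          by_cases hxs : x ∈ s
          · exact Or.inr hxs
          · exact Or.inl (Or.inr ⟨hx, hxs⟩)
      _ ≤ Q (s ∆ A) + Q s := measure_union_le _ _
      _ ≤ ε + (t * ε + C / t) := by
        gcongr
        · exact le_add_self.trans hsA.le
        · exact (h t ht ht' s hs).trans (by gcongr)
      _ = ε + t * ε + C / t := (add_assoc _ _ _).symm
  have bound : ∀ t : ℝ≥0∞, t ≠ 0 → t ≠ ∞ → Q A ≤ C / t := by
    intro t ht ht'
    have lim : Filter.Tendsto (fun ε : ℝ≥0∞ => ε + t * ε + C / t) (nhdsWithin 0 (Ioi 0))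
        (nhds (0 + t * 0 + C / t)) := by
      refine Filter.Tendsto.mono_left ?_ nhdsWithin_le_nhds
      exact (Filter.tendsto_id.add
        (ENNReal.Tendsto.const_mul Filter.tendsto_id (Or.inr ht'))).add_const _
    have := ge_of_tendsto lim (Filter.eventually_of_mem self_mem_nhdsWithin (approx t ht ht'))
    simpa using this
  have lim : Filter.Tendsto (fun n : ℕ => C / (n : ℝ≥0∞)) Filter.atTop (nhds 0) := by
    simpa [div_eq_mul_inv] using
      ENNReal.Tendsto.const_mul ENNReal.tendsto_inv_nat_nhds_zero (Or.inr hC)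
  refine le_antisymm (ge_of_tendsto lim ?_) zero_le
  filter_upwards [Filter.eventually_ge_atTop 1] with n hn
  exact bound n (by positivity) (ENNReal.natCast_ne_top n)

/-- Infinite products of probability measures inherit absolute continuity from their factors when
the chi-squared divergences of the factors are summable. -/
lemma IsProjectiveLimit.absolutelyContinuous_of_summable {ι : Type*} {X : ι → Type*}
    [∀ i, MeasurableSpace (X i)] {μ ν : ∀ i, Measure (X i)}
    [∀ i, IsProbabilityMeasure (μ i)] [∀ i, IsProbabilityMeasure (ν i)]
    {P Q : Measure (∀ i, X i)}
    (hP : IsProjectiveLimit P fun I : Finset ι => Measure.pi fun i : I => μ i)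
    (hQ : IsProjectiveLimit Q fun I : Finset ι => Measure.pi fun i : I => ν i)
    {f : ∀ i, X i → ℝ≥0∞} (hf : ∀ i, Measurable (f i))
    (hν : ∀ i, ν i = (μ i).withDensity (f i))
    {c : ι → ℝ} (hc : ∀ i, 0 ≤ c i) (hsum : Summable c)
    (hfc : ∀ i, ∫⁻ x, f i x ^ 2 ∂μ i ≤ ENNReal.ofReal (1 + c i)) :
    Q ≪ P := by
  have := hP.isFiniteMeasure
  have := hQ.isFiniteMeasure
  refine absolutelyContinuous_of_forall_cylinder_le
    (C := ENNReal.ofReal (exp (∑' i, c i))) ENNReal.ofReal_ne_top fun t ht ht' s hs => ?_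
  obtain ⟨I, S, hS, rfl⟩ := (mem_measurableCylinders s).1 hs
  rw [hP.measure_cylinder I hS, hQ.measure_cylinder I hS]
  have : ∀ i : I, SigmaFinite ((μ i).withDensity (f i)) := fun i => by
    rw [← hν i]; infer_instance
  simp_rw [hν]
  rw [pi_withDensity (fun i : I => μ i) fun i : I => hf i]
  have hfm : Measurable fun x : ∀ i : I, X i => ∏ i : I, f i (x i) :=
    Finset.measurable_prod _ fun i _ => (hf i).comp (measurable_pi_apply i)
  refine (withDensity_le_mul_add_div _ hfm ht ht' hS).trans ?_
  gcongr
  simp_rw [← Finset.prod_pow]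
  rw [lintegral_pi_prod (fun i : I => μ i) (f := fun i x => f i x ^ 2)
    fun i : I => (hf i).pow_const 2]
  calc ∏ i : I, ∫⁻ x, f i x ^ 2 ∂μ i ≤ ∏ i : I, ENNReal.ofReal (1 + c i) :=
        Finset.prod_le_prod' fun i _ => hfc i
    _ = ENNReal.ofReal (∏ i ∈ I, (1 + c i)) := by
        rw [ENNReal.ofReal_prod_of_nonneg fun i _ => add_nonneg zero_le_one (hc i)]
        exact Finset.prod_coe_sort I fun i => ENNReal.ofReal (1 + c i)
    _ ≤ ENNReal.ofReal (exp (∑' i, c i)) := by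
        refine ENNReal.ofReal_le_ofReal ((prod_one_add_le_exp_sum I hc).trans ?_)
        exact exp_le_exp.2 (hsum.sum_le_tsum I fun i _ => hc i)

end ProductMeasures

section Cauchy

lemma lintegral_cauchy_density (δ : ℝ) {γ : ℝ} (hγ : 0 < γ) :
    ∫⁻ x, ENNReal.ofReal (γ / (π * ((x - δ) ^ 2 + γ ^ 2))) = 1 := by
  lift γ to NNReal using hγ.le
  rw [← ProbabilityTheory.lintegral_cauchyPDF_eq_one δ (γ := γ) (by exact_mod_cast hγ.ne')]
  refine lintegral_congr fun x => ?_
  rw [ProbabilityTheory.cauchyPDF_def, ProbabilityTheory.cauchyPDFReal_def]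
  congr 1
  rw [div_eq_mul_inv, mul_inv]
  ring

lemma isProbabilityMeasure_cauchyMeasure (δ : ℝ) {γ : ℝ} (hγ : 0 < γ) :
    IsProbabilityMeasure (cauchyMeasure δ γ) :=
  ⟨by rw [cauchyMeasure, withDensity_apply _ MeasurableSet.univ, Measure.restrict_univ,
    lintegral_cauchy_density δ hγ]⟩

/-- The density of the Cauchy measure with location `δ + h` with respect to the one with
location `δ`. -/
noncomputable def cauchyRatio (δ h γ x : ℝ) : ℝ≥0∞ :=
  ENNReal.ofReal (((x - δ) ^ 2 + γ ^ 2) / ((x - (δ + h)) ^ 2 + γ ^ 2))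

lemma measurable_cauchyRatio (δ h γ : ℝ) : Measurable (cauchyRatio δ h γ) := by
  unfold cauchyRatio
  fun_prop

lemma cauchyMeasure_add_eq_withDensity (δ h : ℝ) {γ : ℝ} (hγ : 0 < γ) :
    cauchyMeasure (δ + h) γ = (cauchyMeasure δ γ).withDensity (cauchyRatio δ h γ) := by
  rw [cauchyMeasure, cauchyMeasure, ← withDensity_mul _ (by fun_prop)
    (measurable_cauchyRatio δ h γ)]
  congr 1
  ext1 x
  rw [Pi.mul_apply, cauchyRatio, ← ENNReal.ofReal_mul (by positivity)]
  congr 1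
  have h₁ : 0 < (x - δ) ^ 2 + γ ^ 2 := by positivity
  field_simp

lemma lintegral_cauchyRatio_sq_le (δ h : ℝ) {γ : ℝ} (hγ : 0 < γ) :
    ∫⁻ x, cauchyRatio δ h γ x ^ 2 ∂cauchyMeasure δ γ ≤ ENNReal.ofReal (1 + (h / γ) ^ 2) := by
  set G : ℝ → ℝ≥0∞ := fun y =>
    ENNReal.ofReal (γ * ((y + h) ^ 2 + γ ^ 2) / (π * (y ^ 2 + γ ^ 2) ^ 2)) with hG
  have hGm : Measurable G := by fun_prop
  have eq : ∫⁻ x, cauchyRatio δ h γ x ^ 2 ∂cauchyMeasure δ γ = ∫⁻ y, G y := by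
    rw [cauchyMeasure, lintegral_withDensity_eq_lintegral_mul _ (by fun_prop)
      ((measurable_cauchyRatio δ h γ).pow_const 2), ← lintegral_sub_right_eq_self G (δ + h)]
    refine lintegral_congr fun x => ?_
    rw [Pi.mul_apply, cauchyRatio, ← ENNReal.ofReal_pow (by positivity),
      ← ENNReal.ofReal_mul (by positivity)]
    simp only [hG]
    congr 1
    have h₁ : 0 < (x - δ) ^ 2 + γ ^ 2 := by positivity
    rw [show x - (δ + h) + h = x - δ by ring]
    field_simp
  have symm_bound : ∀ y, G y + G (-y) ≤
      ENNReal.ofReal (2 * (1 + (h / γ) ^ 2)) *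
        ENNReal.ofReal (γ / (π * ((y - 0) ^ 2 + γ ^ 2))) := by
    intro y
    rw [← ENNReal.ofReal_add (by positivity) (by positivity),
      ← ENNReal.ofReal_mul (by positivity)]
    refine ENNReal.ofReal_le_ofReal ?_
    have hy : 0 < y ^ 2 + γ ^ 2 := by positivity
    have num : h ^ 2 ≤ (h / γ) ^ 2 * (y ^ 2 + γ ^ 2) := by
      rw [div_pow, div_mul_eq_mul_div, le_div_iff₀ (by positivity)]
      nlinarith [mul_nonneg (sq_nonneg h) (sq_nonneg y)]
    calc γ * ((y + h) ^ 2 + γ ^ 2) / (π * (y ^ 2 + γ ^ 2) ^ 2) +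
          γ * ((-y + h) ^ 2 + γ ^ 2) / (π * ((-y) ^ 2 + γ ^ 2) ^ 2)
        = 2 * γ * ((y ^ 2 + γ ^ 2) + h ^ 2) / (π * (y ^ 2 + γ ^ 2) ^ 2) := by
          rw [neg_sq, ← add_div]; ring
      _ ≤ 2 * γ * ((y ^ 2 + γ ^ 2) + (h / γ) ^ 2 * (y ^ 2 + γ ^ 2)) /
          (π * (y ^ 2 + γ ^ 2) ^ 2) := by gcongr
      _ = 2 * (1 + (h / γ) ^ 2) * (γ / (π * ((y - 0) ^ 2 + γ ^ 2))) := by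
          rw [sub_zero]
          field_simp
  have double : 2 * ∫⁻ y, G y ≤ 2 * ENNReal.ofReal (1 + (h / γ) ^ 2) := calc
    2 * ∫⁻ y, G y = ∫⁻ y, (G y + G (-y)) := by
      rw [lintegral_add_left hGm, lintegral_neg_eq_self G, two_mul]
    _ ≤ ∫⁻ y, ENNReal.ofReal (2 * (1 + (h / γ) ^ 2)) *
        ENNReal.ofReal (γ / (π * ((y - 0) ^ 2 + γ ^ 2))) := lintegral_mono symm_bound
    _ = 2 * ENNReal.ofReal (1 + (h / γ) ^ 2) := by
      rw [lintegral_const_mul _ (by fun_prop), lintegral_cauchy_density 0 hγ, mul_one,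
        ENNReal.ofReal_mul zero_le_two, ENNReal.ofReal_ofNat]
  rw [eq]
  exact (ENNReal.mul_le_mul_iff_right two_ne_zero ENNReal.ofNat_ne_top).1 double

lemma cauchy_product_absolutelyContinuous
    (δ h γ : ℕ → ℝ) (hγ : ∀ n, 0 < γ n) {P Q : Measure (ℕ → ℝ)}
    (hP : IsProjectiveLimit P fun I : Finset ℕ =>
      Measure.pi fun i : I => cauchyMeasure (δ i.1) (γ i.1))
    (hQ : IsProjectiveLimit Q fun I : Finset ℕ =>
      Measure.pi fun i : I => cauchyMeasure (δ i.1 + h i.1) (γ i.1))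
    (hsum : Summable fun n => (h n / γ n) ^ 2) :
    Q ≪ P := by
  have := fun n => isProbabilityMeasure_cauchyMeasure (δ n) (hγ n)
  have := fun n => isProbabilityMeasure_cauchyMeasure (δ n + h n) (hγ n)
  exact IsProjectiveLimit.absolutelyContinuous_of_summable
    (μ := fun n => cauchyMeasure (δ n) (γ n)) (ν := fun n => cauchyMeasure (δ n + h n) (γ n))
    hP hQ (fun n => measurable_cauchyRatio (δ n) (h n) (γ n))
    (fun n => cauchyMeasure_add_eq_withDensity (δ n) (h n) (hγ n))
    (fun n => sq_nonneg _) hsum fun n => lintegral_cauchyRatio_sq_le (δ n) (h n) (hγ n)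

end Cauchy

theorem cauchy_product_summable_implies_equivalent
    (δ h γ : ℕ → ℝ) (hγ : ∀ n, 0 < γ n)
    (P Q : Measure (ℕ → ℝ))
    (hP : IsProjectiveLimit P fun I : Finset ℕ =>
      Measure.pi fun i : I => cauchyMeasure (δ i.1) (γ i.1))
    (hQ : IsProjectiveLimit Q fun I : Finset ℕ =>
      Measure.pi fun i : I => cauchyMeasure (δ i.1 + h i.1) (γ i.1))
    (hsum : Summable fun n => (h n / γ n) ^ 2) :
    P ≪ Q ∧ Q ≪ P := by
  refine ⟨?_, cauchy_product_absolutelyContinuous δ h γ hγ hP hQ hsum⟩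
  refine cauchy_product_absolutelyContinuous (fun n => δ n + h n) (fun n => -h n) γ hγ hQ ?_ ?_
  · simpa only [add_neg_cancel_right] using hP
  · simpa only [neg_div, neg_sq] using hsum
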